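/- arXiv:1406.5861 — 4 statements merged into one kernel-verified Lean document; each statement's English description precedes it below -/
import Mathlib

section
/- Let f and g be monic polynomials of degree 5 over ℚ with f(0) = −1 and g(0) = 1 that have no common root in ℂ (i.e., f and g are coprime in ℚ[X]), let A and B be their companion matrices, and set v = (A⁻¹B − I)·e₅ ∈ ℚ⁵, where e₅ is the fifth standard basis vector. Then the set {v, Av, A²v, A³v, A⁴v} is linearly independent over ℚ. -/
open Matrix Polynomial

/-- The companion matrix of a monic polynomial
`p(X) = X^5 + a₄X⁴ + a₃X³ + a₂X² + a₁X + a₀`: it sends `eᵢ` to `e_{i+1}` for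
`1 ≤ i ≤ 4` and `e₅` to `-a₀e₁ - a₁e₂ - a₂e₃ - a₃e₄ - a₄e₅`. -/
def companion (p : Polynomial ℚ) : Matrix (Fin 5) (Fin 5) ℚ :=
  Matrix.of fun i j => if (j : ℕ) = 4 then -p.coeff i
    else if (i : ℕ) = (j : ℕ) + 1 then 1 else 0

lemma natDegree_sub_lt_of_monic {p q : Polynomial ℚ} {n : ℕ} (hn : n ≠ 0) (hp : p.Monic)
    (hq : q.Monic) (hpn : p.natDegree = n) (hqn : q.natDegree = n) : (p - q).natDegree < n := by
  have hd : (p - q).degree < p.degree := by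
    refine degree_sub_lt_left ?_ hp.ne_zero ?_
    · rw [degree_eq_natDegree hp.ne_zero, degree_eq_natDegree hq.ne_zero, hpn, hqn]
    · rw [hp.leadingCoeff, hq.leadingCoeff]
  rcases eq_or_ne (p - q) 0 with h | h
  · rw [h, natDegree_zero]
    exact Nat.pos_of_ne_zero hn
  · rw [← hpn]
    exact natDegree_lt_natDegree h hd

lemma companion_mulVec_single_castSucc (p : Polynomial ℚ) (i : Fin 4) :
    companion p *ᵥ Pi.single i.castSucc 1 = Pi.single i.succ 1 := by
  ext k
  fin_cases i <;> fin_cases k <;> simp [companion]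

lemma companion_mulVec_single_last (p : Polynomial ℚ) :
    companion p *ᵥ Pi.single 4 1 = fun i : Fin 5 => -p.coeff i := by
  ext k
  simp [companion]

lemma companion_pow_mulVec_single_zero (p : Polynomial ℚ) (i : Fin 5) :
    (companion p ^ (i : ℕ)) *ᵥ Pi.single 0 1 = Pi.single i 1 := by
  induction i using Fin.induction with
  | zero => rw [Fin.val_zero, pow_zero, one_mulVec]
  | succ i ih =>
    rw [Fin.val_castSucc] at ih
    rw [Fin.val_succ, pow_succ', ← mulVec_mulVec, ih, companion_mulVec_single_castSucc]

lemma aeval_companion_mulVec_of_natDegree_lt (p q : Polynomial ℚ) (hq : q.natDegree < 5) :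
    (aeval (companion p) q) *ᵥ Pi.single 0 1 = fun i : Fin 5 => q.coeff i := by
  have h : aeval (companion p) q = ∑ i : Fin 5, q.coeff i • companion p ^ (i : ℕ) := by
    rw [aeval_eq_sum_range' hq,
      Fin.sum_univ_eq_sum_range (fun i => q.coeff i • companion p ^ i) 5]
  rw [h, sum_mulVec]
  simp only [smul_mulVec, companion_pow_mulVec_single_zero]
  ext k
  simp [Finset.sum_apply, Pi.single_apply]

lemma aeval_companion_self_mulVec (p : Polynomial ℚ) (hp : p.Monic) (hdeg : p.natDegree = 5) :
    (aeval (companion p) p) *ᵥ Pi.single 0 1 = 0 := by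
  have h4 := companion_pow_mulVec_single_zero p 4
  have hX : (companion p ^ 5) *ᵥ Pi.single 0 1 = fun i : Fin 5 => -p.coeff i := by
    rw [pow_succ', ← mulVec_mulVec, ← companion_mulVec_single_last]
    exact congrArg _ h4
  have hlt : (p - X ^ 5).natDegree < 5 :=
    natDegree_sub_lt_of_monic (by norm_num) hp (monic_X_pow 5) hdeg (natDegree_X_pow 5)
  have hs : p = (p - X ^ 5) + X ^ 5 := by ring
  rw [hs, map_add, add_mulVec, ← hs, aeval_companion_mulVec_of_natDegree_lt p _ hlt, map_pow,
    aeval_X, hX]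
  ext i
  have : (i : ℕ) ≠ 5 := i.isLt.ne
  simp [coeff_X_pow, this]

/-- The vector `e₁` is cyclic for the companion matrix of `p`, with annihilator `(p)`. -/
lemma dvd_of_aeval_companion_mulVec_eq_zero (p q : Polynomial ℚ) (hp : p.Monic)
    (hdeg : p.natDegree = 5) (h : (aeval (companion p) q) *ᵥ Pi.single 0 1 = 0) : p ∣ q := by
  have hlt : (q %ₘ p).natDegree < 5 := by
    rw [← hdeg]
    exact natDegree_modByMonic_lt q hp (by rintro rfl; simp at hdeg)
  rw [← modByMonic_eq_zero_iff_dvd hp]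
  have h0 : (aeval (companion p) (q %ₘ p)) *ᵥ Pi.single 0 1 = 0 := by
    rw [← modByMonic_add_div q p, mul_comm p, map_add, map_mul, add_mulVec, ← mulVec_mulVec,
      aeval_companion_self_mulVec p hp hdeg, mulVec_zero, add_zero] at h
    exact h
  rw [aeval_companion_mulVec_of_natDegree_lt p _ hlt] at h0
  ext n
  by_cases hn : n < 5
  · simpa using congrFun h0 ⟨n, hn⟩
  · rw [coeff_eq_zero_of_natDegree_lt (by omega), coeff_zero]

lemma det_companion (p : Polynomial ℚ) : (companion p).det = -p.coeff 0 := by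
  simp [companion, det_succ_row_zero, Fin.sum_univ_succ, Fin.succAbove, submatrix_apply]
  ring

/-- If `f, g` are monic polynomials of degree `5` over `ℚ` with `f(0) = -1`,
`g(0) = 1`, having no common root (i.e. coprime in `ℚ[X]`), `A, B` are their
companion matrices and `v = (A⁻¹B - I)·e₅`, then `{v, Av, A²v, A³v, A⁴v}` is
linearly independent over `ℚ`. -/
theorem linearIndependent_orbit_of_companion (f g : Polynomial ℚ)
    (hf : f.Monic) (hg : g.Monic) (hfdeg : f.natDegree = 5) (hgdeg : g.natDegree = 5)
    (hf0 : f.coeff 0 = -1) (hg0 : g.coeff 0 = 1) (hcop : IsCoprime f g)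
    (A B : Matrix (Fin 5) (Fin 5) ℚ) (hA : A = companion f) (hB : B = companion g)
    (v : Fin 5 → ℚ) (hv : v = (A⁻¹ * B - 1) *ᵥ Pi.single 4 1) :
    LinearIndependent ℚ ![v, A *ᵥ v, (A ^ 2) *ᵥ v, (A ^ 3) *ᵥ v, (A ^ 4) *ᵥ v] := by
  have hlt : (f - g).natDegree < 5 :=
    natDegree_sub_lt_of_monic (by norm_num) hf hg hfdeg hgdeg
  have hdet : IsUnit A.det := by
    rw [hA, det_companion, hf0]
    norm_num
  have hAv : A *ᵥ v = (aeval A (f - g)) *ᵥ Pi.single 0 1 := by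
    rw [hv, mulVec_mulVec, mul_sub, mul_nonsing_inv_cancel_left _ _ hdet, mul_one, sub_mulVec, hA,
      hB, companion_mulVec_single_last, companion_mulVec_single_last,
      aeval_companion_mulVec_of_natDegree_lt f _ hlt]
    ext i
    simp only [Pi.sub_apply, coeff_sub]
    ring
  have hfam : ![v, A *ᵥ v, (A ^ 2) *ᵥ v, (A ^ 3) *ᵥ v, (A ^ 4) *ᵥ v] =
      fun i : Fin 5 => (A ^ (i : ℕ)) *ᵥ v := by
    ext i
    fin_cases i <;> simp
  rw [hfam, Fintype.linearIndependent_iff]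
  intro c hc
  set q : Polynomial ℚ := ∑ i : Fin 5, C (c i) * X ^ (i : ℕ) with hq
  have hqv : (aeval A q) *ᵥ v = 0 := by
    rw [← hc, hq, map_sum, sum_mulVec]
    refine Finset.sum_congr rfl fun i _ => ?_
    rw [map_mul, aeval_C, map_pow, aeval_X, ← Algebra.smul_def, smul_mulVec]
  have hdvd : f ∣ q * (f - g) := by
    refine dvd_of_aeval_companion_mulVec_eq_zero f _ hf hfdeg ?_
    rw [← hA, map_mul, ← mulVec_mulVec, ← hAv, mulVec_mulVec]
    have hcomm : aeval A q * A = A * aeval A q := by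
      simpa using congrArg (aeval A) (mul_comm q X)
    rw [hcomm, ← mulVec_mulVec, hqv, mulVec_zero]
  have hcop' : IsCoprime f (f - g) := by
    obtain ⟨a, b, h⟩ := hcop
    exact ⟨a + b, -b, by linear_combination h⟩
  have hq0 : q = 0 := by
    refine eq_zero_of_dvd_of_degree_lt (hcop'.dvd_of_dvd_mul_right hdvd) ?_
    rw [degree_eq_natDegree hf.ne_zero, hfdeg]
    exact degree_sum_fin_lt c
  intro i
  have h := congrArg (fun r => coeff r (i : ℕ)) hq0
  simpa [hq, finsetSum_coeff, coeff_X_pow, Fin.val_inj] using h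
end

section
/- For each of the 14 tuples (r₀,r₁,r₂,r₃,r₄) in the list [(57,39,−7,−57,−71), (3,0,−5,0,35), (27,5,−37,−27,155), (67,7,−101,−41,547), (17,7,−15,−25,17), (11,3,−13,−13,43), (115,37,−125,−155,307), (89,39,−71,−121,89), (27,15,−13,−33,−5), (265,151,−119,−329,−119), (35,21,−13,−43,−29), (65,47,1,−49,−63), (141,115,45,−45,−115), (257,223,129,−1,−127)], the symmetric 5×5 integer matrix Q with (i,j)-entry r_{|i−j|}, regarded as a real symmetric matrix, is nondegenerate and has signature (3,2) or (2,3): there exists an invertible real 5×5 matrix P such that Pᵀ Q P is diagonal with exactly three positive and two negative diagonal entries, or with exactly two positive and three negative diagonal entries. -/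
open Matrix

/-- The symmetric Toeplitz matrix whose `(i,j)` entry is `r_{|i-j|}`. -/
def toepQ (r : List ℤ) : Matrix (Fin 5) (Fin 5) ℤ :=
  Matrix.of fun i j => r.getD ((i : ℤ) - (j : ℤ)).natAbs 0

/-- A basis orthogonal for `toepQ r`, as the columns of a matrix. The first two columns span the
vectors antisymmetric under reversal of the coordinates, the last three the symmetric ones; each of
the two blocks is orthogonalized without denominators. -/
def toepBasis (r : List ℤ) : Matrix (Fin 5) (Fin 5) ℤ :=
  let r₀ := r.getD 0 0
  let r₁ := r.getD 1 0
  let r₂ := r.getD 2 0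
  let r₃ := r.getD 3 0
  let b := r₃ - r₁
  let c := r₀ - r₂
  let x := 2 * (r₁ * (r₁ + r₃) - r₂ * (r₀ + r₂))
  let y := 2 * (r₁ * r₂) - r₀ * (r₁ + r₃)
  let z := r₀ * (r₀ + r₂) - 2 * r₁ ^ 2
  !![0, c, 0, 0, z;
     1, b, 0, r₀, y;
     0, 0, 1, -2 * r₁, x;
     -1, -b, 0, r₀, y;
     0, -c, 0, 0, z]

/-- The sign pattern of a diagonal form of signature `(3,2)` or `(2,3)`. -/
def HasSigns {R : Type*} [Zero R] [LT R] [DecidableLT R] (d : Fin 5 → R) : Prop :=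
  ((Finset.univ.filter fun i => 0 < d i).card = 3 ∧
    (Finset.univ.filter fun i => d i < 0).card = 2) ∨
  ((Finset.univ.filter fun i => 0 < d i).card = 2 ∧
    (Finset.univ.filter fun i => d i < 0).card = 3)

instance (d : Fin 5 → ℤ) : Decidable (HasSigns d) := by
  unfold HasSigns; infer_instance

theorem HasSigns.ne_zero {d : Fin 5 → ℝ} (h : HasSigns d) (i : Fin 5) : d i ≠ 0 := by
  intro hi
  have hdisj : Disjoint (Finset.univ.filter fun i => 0 < d i)
      (Finset.univ.filter fun i => d i < 0) :=
    Finset.disjoint_filter.2 fun j _ hj => hj.not_gt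
  have hsub : (Finset.univ.filter fun i => 0 < d i) ∪ (Finset.univ.filter fun i => d i < 0) ⊆
      Finset.univ.erase i := by
    intro j hj
    rw [Finset.mem_erase]
    refine ⟨?_, Finset.mem_univ j⟩
    rintro rfl
    simp [hi] at hj
  have hcard := Finset.card_le_card hsub
  rw [Finset.card_union_of_disjoint hdisj, Finset.card_erase_of_mem (Finset.mem_univ i),
    Finset.card_univ, Fintype.card_fin] at hcard
  rcases h with ⟨h₁, h₂⟩ | ⟨h₁, h₂⟩ <;> omega

/-- A diagonalization over `ℤ` with the right signs yields one over `ℝ`, and forces both the form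
and the change of basis to be nondegenerate. -/
theorem exists_real_diagonalization {A P : Matrix (Fin 5) (Fin 5) ℤ} {d : Fin 5 → ℤ}
    (h : Pᵀ * A * P = Matrix.diagonal d) (hd : HasSigns d) :
    (A.map (fun n => (n : ℝ))).det ≠ 0 ∧
      ∃ P : Matrix (Fin 5) (Fin 5) ℝ, P.det ≠ 0 ∧
        ∃ d : Fin 5 → ℝ, Pᵀ * A.map (fun n => (n : ℝ)) * P = Matrix.diagonal d ∧
          HasSigns d := by
  have hreal : (P.map (Int.castRingHom ℝ))ᵀ * A.map (Int.castRingHom ℝ) *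
      P.map (Int.castRingHom ℝ) = Matrix.diagonal fun i => (d i : ℝ) := by
    rw [← Matrix.transpose_map, ← Matrix.map_mul, ← Matrix.map_mul, h,
      Matrix.diagonal_map (map_zero _)]
    rfl
  have hsigns : HasSigns fun i => (d i : ℝ) := by
    simpa only [HasSigns, Int.cast_pos, Int.cast_lt_zero] using hd
  have hdet : ((P.map (Int.castRingHom ℝ))ᵀ * A.map (Int.castRingHom ℝ) *
      P.map (Int.castRingHom ℝ)).det ≠ 0 := by
    rw [hreal, Matrix.det_diagonal]
    exact Finset.prod_ne_zero_iff.2 fun i _ => hsigns.ne_zero i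
  rw [Matrix.det_mul, Matrix.det_mul] at hdet
  exact ⟨right_ne_zero_of_mul (left_ne_zero_of_mul hdet), P.map (Int.castRingHom ℝ),
    right_ne_zero_of_mul hdet, _, hreal, hsigns⟩

/-- The invariant quadratic forms of the 14 orthogonal hypergeometric groups
with a maximally unipotent monodromy are nondegenerate of signature `(3,2)`
or `(2,3)`. -/
theorem signature_of_fourteen_quadratic_forms :
    ∀ r ∈ [[(57:ℤ), 39, -7, -57, -71],
           [3, 0, -5, 0, 35],
           [27, 5, -37, -27, 155],
           [67, 7, -101, -41, 547],
           [17, 7, -15, -25, 17],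
           [11, 3, -13, -13, 43],
           [115, 37, -125, -155, 307],
           [89, 39, -71, -121, 89],
           [27, 15, -13, -33, -5],
           [265, 151, -119, -329, -119],
           [35, 21, -13, -43, -29],
           [65, 47, 1, -49, -63],
           [141, 115, 45, -45, -115],
           [257, 223, 129, -1, -127]],
      ∀ Q : Matrix (Fin 5) (Fin 5) ℝ, Q = (toepQ r).map (fun n => (n : ℝ)) →
        Q.det ≠ 0 ∧
        ∃ P : Matrix (Fin 5) (Fin 5) ℝ, P.det ≠ 0 ∧
          ∃ d : Fin 5 → ℝ, Pᵀ * Q * P = Matrix.diagonal d ∧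
            (((Finset.univ.filter fun i => 0 < d i).card = 3 ∧
              (Finset.univ.filter fun i => d i < 0).card = 2) ∨
             ((Finset.univ.filter fun i => 0 < d i).card = 2 ∧
              (Finset.univ.filter fun i => d i < 0).card = 3)) := by
  intro r hr Q hQ
  subst hQ
  have hcert : (toepBasis r)ᵀ * toepQ r * toepBasis r =
      Matrix.diagonal (fun i => ((toepBasis r)ᵀ * toepQ r * toepBasis r) i i) ∧
      HasSigns fun i => ((toepBasis r)ᵀ * toepQ r * toepBasis r) i i := by
    revert r
    decide +kernel
  exact exists_real_diagonalization hcert.1 hcert.2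
end

section
/- Let x and y be the 5×5 rational matrices x = [[0,−1,0,0,2],[0,0,0,0,1],[0,1,−1,0,−1],[1,4,−8,2,−4],[0,−4,8,−1,4]] and y = [[0,−4,8,−1,5],[0,0,0,0,1],[0,1,−1,0,−1],[1,1,0,1,−1],[0,−1,0,0,1]] (rows listed top to bottom). Then each of the four unipotent lower-triangular matrices I + 2E₄₁ − 2E₅₂, I + 8E₃₂ + 256E₄₂ + 64E₄₃, I − 16E₃₁ + 1024E₅₁ − 128E₅₃, and I + 16E₂₁ − 16E₅₄ belongs to the subgroup of GL(5,ℚ) generated by x and y. -/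
open Matrix

/-- Matrix of the generator `x`. -/
def xMat : Matrix (Fin 5) (Fin 5) ℚ :=
  !![0, -1, 0, 0, 2;
     0, 0, 0, 0, 1;
     0, 1, -1, 0, -1;
     1, 4, -8, 2, -4;
     0, -4, 8, -1, 4]

/-- Matrix of the generator `y`. -/
def yMat : Matrix (Fin 5) (Fin 5) ℚ :=
  !![0, -4, 8, -1, 5;
     0, 0, 0, 0, 1;
     0, 1, -1, 0, -1;
     1, 1, 0, 1, -1;
     0, -1, 0, 0, 1]

/-- Matrix of `x⁻¹`. -/
def xInvMat : Matrix (Fin 5) (Fin 5) ℚ :=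
  !![4, -4, 8, 1, 2;
     -1, 2, 0, 0, 0;
     -1, 1, -1, 0, 0;
     -4, 4, -8, 0, -1;
     0, 1, 0, 0, 0]

/-- Matrix of `y⁻¹`. -/
def yInvMat : Matrix (Fin 5) (Fin 5) ℚ :=
  !![1, -1, 8, 1, 5;
     0, 1, 0, 0, -1;
     0, 0, -1, 0, -1;
     -1, 1, -8, 0, -4;
     0, 1, 0, 0, 0]

theorem xMat_mul_xInvMat : xMat * xInvMat = 1 := by
  ext i j
  fin_cases i <;> fin_cases j <;> norm_num [xMat, xInvMat]

theorem yMat_mul_yInvMat : yMat * yInvMat = 1 := by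
  ext i j
  fin_cases i <;> fin_cases j <;> norm_num [yMat, yInvMat]

theorem one_add_two_E41_mem {N : Submonoid (Matrix (Fin 5) (Fin 5) ℚ)}
    (hx : xMat ∈ N) (hy : yMat ∈ N) (hy' : yInvMat ∈ N) :
    !![1, 0, 0, 0, 0;
       0, 1, 0, 0, 0;
       0, 0, 1, 0, 0;
       2, 0, 0, 1, 0;
       0, -2, 0, 0, 1] ∈ N := by
  have h :
      xMat * yMat ^ 5 * xMat * yInvMat =
        !![1, 0, 0, 0, 0;
           0, 1, 0, 0, 0;
           0, 0, 1, 0, 0;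
           2, 0, 0, 1, 0;
           0, -2, 0, 0, 1] := by
    norm_num [xMat, yMat, xInvMat, yInvMat, pow_succ]
  rw [← h]
  repeat' first | assumption | apply pow_mem | apply mul_mem

theorem one_add_eight_E32_mem {N : Submonoid (Matrix (Fin 5) (Fin 5) ℚ)}
    (hx : xMat ∈ N) (hy : yMat ∈ N) (hx' : xInvMat ∈ N) (hy' : yInvMat ∈ N) :
    !![1, 0, 0, 0, 0;
       0, 1, 0, 0, 0;
       0, 8, 1, 0, 0;
       0, 256, 64, 1, 0;
       0, 0, 0, 0, 1] ∈ N := by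
  have a :
      yMat ^ 2 * xMat ^ 2 * yMat ^ 2 * xMat * yMat * xMat ^ 2 * yMat ^ 2 * xMat * yMat *
      xMat ^ 3 * yMat ^ 2 * xMat * yMat * xMat * yMat ^ 2 * xMat =
        !![1, 0, 0, 0, 0;
           0, 1, 0, 0, 0;
           0, 4, -1, 0, 0;
           -7, 64, -32, 1, 0;
           0, 7, 0, 0, 1] := by
    norm_num [xMat, yMat, xInvMat, yInvMat, pow_succ]
  have b :
      yInvMat * xInvMat ^ 2 * yInvMat ^ 2 * xInvMat * yInvMat * xInvMat ^ 2 * yInvMat ^ 2 *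
      xInvMat * yInvMat * xInvMat ^ 3 * yInvMat ^ 2 * xInvMat * yInvMat * xInvMat *
      yInvMat ^ 2 * xInvMat * yInvMat =
        !![1, 0, 0, 0, 0;
           0, 1, 0, 0, 0;
           0, -4, -1, 0, 0;
           7, 64, 32, 1, 0;
           0, -7, 0, 0, 1] := by
    norm_num [xMat, yMat, xInvMat, yInvMat, pow_succ]
  have h :
      (!![1, 0, 0, 0, 0;
          0, 1, 0, 0, 0;
          0, 4, -1, 0, 0;
          -7, 64, -32, 1, 0;
          0, 7, 0, 0, 1] :
          Matrix (Fin 5) (Fin 5) ℚ) *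
      !![1, 0, 0, 0, 0;
         0, 1, 0, 0, 0;
         0, -4, -1, 0, 0;
         7, 64, 32, 1, 0;
         0, -7, 0, 0, 1] =
        !![1, 0, 0, 0, 0;
           0, 1, 0, 0, 0;
           0, 8, 1, 0, 0;
           0, 256, 64, 1, 0;
           0, 0, 0, 0, 1] := by
    norm_num
  rw [← h, ← a, ← b]
  repeat' first | assumption | apply pow_mem | apply mul_mem

theorem one_sub_sixteen_E31_mem {N : Submonoid (Matrix (Fin 5) (Fin 5) ℚ)}
    (hx : xMat ∈ N) (hy : yMat ∈ N) (hx' : xInvMat ∈ N) (hy' : yInvMat ∈ N) :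
    !![1, 0, 0, 0, 0;
       0, 1, 0, 0, 0;
       -16, 0, 1, 0, 0;
       0, 0, 0, 1, 0;
       1024, 0, -128, 0, 1] ∈ N := by
  have a :
      yMat ^ 4 * xInvMat ^ 2 * yInvMat ^ 5 * xInvMat ^ 2 * yInvMat ^ 6 =
        !![1, 0, 0, 0, 0;
           -1, 1, 0, 0, 0;
           -3, 0, -1, 0, 0;
           -10, 0, 0, 1, 0;
           26, 10, 24, 1, 1] := by
    norm_num [xMat, yMat, xInvMat, yInvMat, pow_succ]
  have b :
      xInvMat * yInvMat ^ 3 * xMat * yMat * xInvMat ^ 2 * yInvMat ^ 2 * xInvMat * yInvMat *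
      xInvMat * yMat ^ 2 * xMat * yInvMat ^ 2 * xInvMat * yInvMat ^ 3 =
        !![-1, 0, 0, 0, 0;
           -6, -1, 0, 0, 0;
           -6, -2, 1, 0, 0;
           -20, -16, 16, -1, 0;
           -24, 20, -48, 6, -1] := by
    norm_num [xMat, yMat, xInvMat, yInvMat, pow_succ]
  have c :
      xMat ^ 3 * yMat ^ 2 * xMat * yMat * xMat ^ 2 * yMat ^ 5 * xMat * yMat * xMat ^ 2 * yMat *
      xMat * yMat ^ 2 * xMat ^ 2 * yInvMat =
        !![-1, 0, 0, 0, 0;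
           5, -1, 0, 0, 0;
           17, -2, -1, 0, 0;
           202, -16, -16, -1, 0;
           -146, -10, 56, -5, -1] := by
    norm_num [xMat, yMat, xInvMat, yInvMat, pow_succ]
  have h :
      (!![1, 0, 0, 0, 0;
          -1, 1, 0, 0, 0;
          -3, 0, -1, 0, 0;
          -10, 0, 0, 1, 0;
          26, 10, 24, 1, 1] :
          Matrix (Fin 5) (Fin 5) ℚ) *
      !![-1, 0, 0, 0, 0;
         -6, -1, 0, 0, 0;
         -6, -2, 1, 0, 0;
         -20, -16, 16, -1, 0;
         -24, 20, -48, 6, -1] *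
      !![-1, 0, 0, 0, 0;
         5, -1, 0, 0, 0;
         17, -2, -1, 0, 0;
         202, -16, -16, -1, 0;
         -146, -10, 56, -5, -1] =
        !![1, 0, 0, 0, 0;
           0, 1, 0, 0, 0;
           -16, 0, 1, 0, 0;
           0, 0, 0, 1, 0;
           1024, 0, -128, 0, 1] := by
    norm_num
  rw [← h, ← a, ← b, ← c]
  repeat' first | assumption | apply pow_mem | apply mul_mem

theorem one_add_sixteen_E21_mem {N : Submonoid (Matrix (Fin 5) (Fin 5) ℚ)}
    (hx : xMat ∈ N) (hy : yMat ∈ N) (hx' : xInvMat ∈ N) (hy' : yInvMat ∈ N) :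
    !![1, 0, 0, 0, 0;
       16, 1, 0, 0, 0;
       0, 0, 1, 0, 0;
       0, 0, 0, 1, 0;
       0, 0, 0, -16, 1] ∈ N := by
  have a :
      yMat ^ 9 * xMat * yInvMat ^ 2 * xInvMat =
        !![-1, 0, 0, 0, 0;
           1, -1, 0, 0, 0;
           -1, 2, -1, 0, 0;
           10, -16, 16, -1, 0;
           6, -10, 8, -1, -1] := by
    norm_num [xMat, yMat, xInvMat, yInvMat, pow_succ]
  have b :
      yMat ^ 3 * xMat * yMat * xMat * yMat ^ 2 * xMat * yInvMat * xInvMat * yInvMat ^ 2 *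
      xInvMat * yInvMat * xInvMat * yInvMat ^ 6 =
        !![1, 0, 0, 0, 0;
           3, 1, 0, 0, 0;
           1, 0, 1, 0, 0;
           1, 0, 0, 1, 0;
           1, -1, 8, -3, 1] := by
    norm_num [xMat, yMat, xInvMat, yInvMat, pow_succ]
  have c :
      yInvMat ^ 3 * xMat ^ 2 * yMat ^ 2 * xMat ^ 2 * yMat * xMat ^ 2 * yMat ^ 2 * xMat * yMat *
      xMat ^ 2 * yMat ^ 2 * xMat * yInvMat ^ 2 =
        !![1, 0, 0, 0, 0;
           -1, 1, 0, 0, 0;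
           -7, 4, -1, 0, 0;
           -142, 64, -32, 1, 0;
           54, -18, 24, 1, 1] := by
    norm_num [xMat, yMat, xInvMat, yInvMat, pow_succ]
  have d :
      xInvMat * yInvMat ^ 2 * xInvMat * yInvMat * xInvMat * yInvMat * xInvMat * yInvMat ^ 3 *
      xInvMat ^ 2 * yInvMat ^ 3 * xInvMat * yMat * xMat * yMat ^ 3 =
        !![-1, 0, 0, 0, 0;
           -15, -1, 0, 0, 0;
           -21, -2, 1, 0, 0;
           -119, -16, 16, -1, 0;
           21, 23, -72, 15, -1] := by
    norm_num [xMat, yMat, xInvMat, yInvMat, pow_succ]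
  have h :
      (!![-1, 0, 0, 0, 0;
          1, -1, 0, 0, 0;
          -1, 2, -1, 0, 0;
          10, -16, 16, -1, 0;
          6, -10, 8, -1, -1] :
          Matrix (Fin 5) (Fin 5) ℚ) *
      !![1, 0, 0, 0, 0;
         3, 1, 0, 0, 0;
         1, 0, 1, 0, 0;
         1, 0, 0, 1, 0;
         1, -1, 8, -3, 1] *
      !![1, 0, 0, 0, 0;
         -1, 1, 0, 0, 0;
         -7, 4, -1, 0, 0;
         -142, 64, -32, 1, 0;
         54, -18, 24, 1, 1] *
      !![-1, 0, 0, 0, 0;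
         -15, -1, 0, 0, 0;
         -21, -2, 1, 0, 0;
         -119, -16, 16, -1, 0;
         21, 23, -72, 15, -1] =
        !![1, 0, 0, 0, 0;
           16, 1, 0, 0, 0;
           0, 0, 1, 0, 0;
           0, 0, 0, 1, 0;
           0, 0, 0, -16, 1] := by
    norm_num
  rw [← h, ← a, ← b, ← c, ← d]
  repeat' first | assumption | apply pow_mem | apply mul_mem


open Matrix

/-- The hypergeometric group with parameters `α = (0,0,0,0,0)`,
`β = (1/6, 1/6, 5/6, 5/6, 1/2)`, written in a basis adapted to the invariant
quadratic form (generated by `x` and `y` below), contains the four listed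
nontrivial unipotent lower-triangular elements `I + 2E₄₁ - 2E₅₂`,
`I + 8E₃₂ + 256E₄₂ + 64E₄₃`, `I - 16E₃₁ + 1024E₅₁ - 128E₅₃` and
`I + 16E₂₁ - 16E₅₄`. -/
theorem unipotents_in_closure_one_sixth (x y : Matrix.GeneralLinearGroup (Fin 5) ℚ)
    (hx : (x : Matrix (Fin 5) (Fin 5) ℚ) =
      !![0, -1,  0,  0,  2;
         0,  0,  0,  0,  1;
         0,  1, -1,  0, -1;
         1,  4, -8,  2, -4;
         0, -4,  8, -1,  4])
    (hy : (y : Matrix (Fin 5) (Fin 5) ℚ) =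
      !![0, -4,  8, -1,  5;
         0,  0,  0,  0,  1;
         0,  1, -1,  0, -1;
         1,  1,  0,  1, -1;
         0, -1,  0,  0,  1]) :
    ∀ c ∈ [(!![1,    0,    0,   0, 0;
               0,    1,    0,   0, 0;
               0,    0,    1,   0, 0;
               2,    0,    0,   1, 0;
               0,   -2,    0,   0, 1] : Matrix (Fin 5) (Fin 5) ℚ),
            !![1,    0,    0,   0, 0;
               0,    1,    0,   0, 0;
               0,    8,    1,   0, 0;
               0,  256,   64,   1, 0;
               0,    0,    0,   0, 1],
            !![1,    0,    0,   0, 0;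
               0,    1,    0,   0, 0;
             -16,    0,    1,   0, 0;
               0,    0,    0,   1, 0;
            1024,    0, -128,   0, 1],
            !![1,    0,    0,   0, 0;
              16,    1,    0,   0, 0;
               0,    0,    1,   0, 0;
               0,    0,    0,   1, 0;
               0,    0,    0, -16, 1]],
      ∃ g ∈ Subgroup.closure {x, y}, (g : Matrix (Fin 5) (Fin 5) ℚ) = c := by
  have hx₁ : (x : Matrix (Fin 5) (Fin 5) ℚ) = xMat := hx
  have hy₁ : (y : Matrix (Fin 5) (Fin 5) ℚ) = yMat := hy
  have hx₂ : ((x⁻¹ : Matrix.GeneralLinearGroup (Fin 5) ℚ) : Matrix (Fin 5) (Fin 5) ℚ) = xInvMat :=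
    Units.inv_eq_of_mul_eq_one_right (hx₁ ▸ xMat_mul_xInvMat)
  have hy₂ : ((y⁻¹ : Matrix.GeneralLinearGroup (Fin 5) ℚ) : Matrix (Fin 5) (Fin 5) ℚ) = yInvMat :=
    Units.inv_eq_of_mul_eq_one_right (hy₁ ▸ yMat_mul_yInvMat)
  have hxm : x ∈ Subgroup.closure {x, y} := Subgroup.subset_closure (by simp)
  have hym : y ∈ Subgroup.closure {x, y} := Subgroup.subset_closure (by simp)
  let N := (Subgroup.closure {x, y}).toSubmonoid.map (Units.coeHom (Matrix (Fin 5) (Fin 5) ℚ))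
  have hX : xMat ∈ N := ⟨x, hxm, hx₁⟩
  have hY : yMat ∈ N := ⟨y, hym, hy₁⟩
  have hX' : xInvMat ∈ N := ⟨x⁻¹, Subgroup.inv_mem _ hxm, hx₂⟩
  have hY' : yInvMat ∈ N := ⟨y⁻¹, Subgroup.inv_mem _ hym, hy₂⟩
  intro c hc
  change c ∈ N
  simp only [List.mem_cons, List.not_mem_nil, or_false] at hc
  rcases hc with rfl | rfl | rfl | rfl
  · exact one_add_two_E41_mem hX hY hY'
  · exact one_add_eight_E32_mem hX hY hX' hY'
  · exact one_sub_sixteen_E31_mem hX hY hX' hY'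
  · exact one_add_sixteen_E21_mem hX hY hX' hY'
end

section
/- Let x and y be the 5×5 rational matrices x = [[0,−8,−4,−1/32,−51/16],[2,20,0,−7/8,35/4],[0,−4,−1,0,−7/4],[0,0,0,0,1/2],[0,−32,0,0,−14]] and y = [[0,−1/2,−4,−1/2,3/32],[2,0,0,3/8,0],[0,0,−1,−1/4,0],[0,0,0,0,1/2],[0,0,0,−2,0]] (rows listed top to bottom). Then each of the four unipotent upper-triangular matrices I − E₁₄ + E₂₅, I − 128E₁₃ + 256E₁₅ − 4E₃₅, I − 16E₁₂ + 16E₄₅, and I + 8192E₂₃ + 1048576E₂₄ + 256E₃₄ belongs to the subgroup of GL(5,ℚ) generated by x and y. -/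
open Matrix

/-- The one-parameter subgroup of the highest root `e₁ + e₂`. -/
def longHighestRoot (a : ℚ) : Matrix (Fin 5) (Fin 5) ℚ :=
  !![1, 0, 0, -a, 0;
     0, 1, 0,  0, a;
     0, 0, 1,  0, 0;
     0, 0, 0,  1, 0;
     0, 0, 0,  0, 1]

/-- The one-parameter subgroup of the short root `e₁`. -/
def shortHighestRoot (a : ℚ) : Matrix (Fin 5) (Fin 5) ℚ :=
  !![1, 0, a, 0, a ^ 2 / 64;
     0, 1, 0, 0,          0;
     0, 0, 1, 0,     a / 32;
     0, 0, 0, 1,          0;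
     0, 0, 0, 0,          1]

/-- The one-parameter subgroup of the long simple root `e₁ - e₂`. -/
def longSimpleRoot (a : ℚ) : Matrix (Fin 5) (Fin 5) ℚ :=
  !![1, -a, 0, 0, 0;
     0,  1, 0, 0, 0;
     0,  0, 1, 0, 0;
     0,  0, 0, 1, a;
     0,  0, 0, 0, 1]

/-- The one-parameter subgroup of the short simple root `e₂`. -/
def shortSimpleRoot (a : ℚ) : Matrix (Fin 5) (Fin 5) ℚ :=
  !![1, 0, 0,          0, 0;
     0, 1, a, a ^ 2 / 64, 0;
     0, 0, 1,     a / 32, 0;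
     0, 0, 0,          1, 0;
     0, 0, 0,          0, 1]

theorem pow_of_map_add {M : Type*} [Monoid M] {f : ℚ → M} (h0 : f 0 = 1)
    (hadd : ∀ a b, f (a + b) = f a * f b) (a : ℚ) (n : ℕ) : f a ^ n = f (n * a) := by
  induction n with
  | zero => simp [h0]
  | succ n ih => rw [pow_succ, ih, ← hadd]; push_cast; ring_nf

theorem longHighestRoot_pow (a : ℚ) (n : ℕ) :
    longHighestRoot a ^ n = longHighestRoot (n * a) := by
  refine pow_of_map_add ?_ (fun a b => ?_) a n
  · ext i j
    fin_cases i <;> fin_cases j <;> simp [longHighestRoot]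
  · ext i j
    fin_cases i <;> fin_cases j <;>
      simp [longHighestRoot, Matrix.mul_apply, Fin.sum_univ_five, add_comm]

theorem shortHighestRoot_pow (a : ℚ) (n : ℕ) :
    shortHighestRoot a ^ n = shortHighestRoot (n * a) := by
  refine pow_of_map_add ?_ (fun a b => ?_) a n
  · ext i j
    fin_cases i <;> fin_cases j <;> simp [shortHighestRoot]
  · ext i j
    fin_cases i <;> fin_cases j <;>
      simp [shortHighestRoot, Matrix.mul_apply, Fin.sum_univ_five] <;> ring

theorem longSimpleRoot_pow (a : ℚ) (n : ℕ) :
    longSimpleRoot a ^ n = longSimpleRoot (n * a) := by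
  refine pow_of_map_add ?_ (fun a b => ?_) a n
  · ext i j
    fin_cases i <;> fin_cases j <;> simp [longSimpleRoot]
  · ext i j
    fin_cases i <;> fin_cases j <;>
      simp [longSimpleRoot, Matrix.mul_apply, Fin.sum_univ_five, add_comm]

theorem shortSimpleRoot_pow (a : ℚ) (n : ℕ) :
    shortSimpleRoot a ^ n = shortSimpleRoot (n * a) := by
  refine pow_of_map_add ?_ (fun a b => ?_) a n
  · ext i j
    fin_cases i <;> fin_cases j <;> simp [shortSimpleRoot]
  · ext i j
    fin_cases i <;> fin_cases j <;>
      simp [shortSimpleRoot, Matrix.mul_apply, Fin.sum_univ_five] <;> ring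

/-- The hypergeometric group with parameters `α = (0,0,0,0,0)`,
`β = (1/4, 1/4, 3/4, 3/4, 1/2)`, written in a basis adapted to the invariant
quadratic form (generated by `x` and `y` below), contains the four listed
nontrivial unipotent upper-triangular elements `I - E₁₄ + E₂₅`,
`I - 128E₁₃ + 256E₁₅ - 4E₃₅`, `I - 16E₁₂ + 16E₄₅` and
`I + 8192E₂₃ + 1048576E₂₄ + 256E₃₄`. -/
theorem unipotents_in_closure_one_fourth (x y : Matrix.GeneralLinearGroup (Fin 5) ℚ)
    (hx : (x : Matrix (Fin 5) (Fin 5) ℚ) =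
      !![0,  -8, -4, -1/32, -51/16;
         2,  20,  0,  -7/8,   35/4;
         0,  -4, -1,     0,   -7/4;
         0,   0,  0,     0,    1/2;
         0, -32,  0,     0,    -14])
    (hy : (y : Matrix (Fin 5) (Fin 5) ℚ) =
      !![0, -1/2, -4, -1/2, 3/32;
         2,    0,  0,  3/8,    0;
         0,    0, -1, -1/4,    0;
         0,    0,  0,    0,  1/2;
         0,    0,  0,   -2,    0]) :
    ∀ c ∈ [(!![1, 0, 0, -1, 0;
               0, 1, 0,  0, 1;
               0, 0, 1,  0, 0;
               0, 0, 0,  1, 0;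
               0, 0, 0,  0, 1] : Matrix (Fin 5) (Fin 5) ℚ),
            !![1, 0, -128, 0, 256;
               0, 1,    0, 0,   0;
               0, 0,    1, 0,  -4;
               0, 0,    0, 1,   0;
               0, 0,    0, 0,   1],
            !![1, -16, 0, 0,  0;
               0,   1, 0, 0,  0;
               0,   0, 1, 0,  0;
               0,   0, 0, 1, 16;
               0,   0, 0, 0,  1],
            !![1, 0,    0,       0, 0;
               0, 1, 8192, 1048576, 0;
               0, 0,    1,     256, 0;
               0, 0,    0,       1, 0;
               0, 0,    0,       0, 1]],
      ∃ g ∈ Subgroup.closure {x, y}, (g : Matrix (Fin 5) (Fin 5) ℚ) = c := by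
  have hxG : x ∈ Subgroup.closure {x, y} := Subgroup.subset_closure (by simp)
  have hyG : y ∈ Subgroup.closure {x, y} := Subgroup.subset_closure (by simp)
  have val_mul_inv (a b : GeneralLinearGroup (Fin 5) ℚ) (c : Matrix (Fin 5) (Fin 5) ℚ)
      (h : (a : Matrix (Fin 5) (Fin 5) ℚ) = c * b) :
      ((a * b⁻¹ : GeneralLinearGroup (Fin 5) ℚ) : Matrix (Fin 5) (Fin 5) ℚ) = c := by
    rw [Units.val_mul, h, Units.mul_inv_cancel_right]
  have hy2 : (y : Matrix (Fin 5) (Fin 5) ℚ) ^ 2 =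
      !![-1,  0,  4, 5/8, -1/4;
          0, -1, -8,  -1,  3/8;
          0,  0,  1, 1/4, -1/8;
          0,  0,  0,  -1,    0;
          0,  0,  0,   0,   -1] := by
    rw [hy, pow_two]
    norm_num
  have hy4 : (y : Matrix (Fin 5) (Fin 5) ℚ) ^ 4 = longHighestRoot (1 / 4) := by
    rw [show 4 = 2 * 2 from rfl, pow_mul, hy2, pow_two, longHighestRoot]
    norm_num
  have hw : ((x * y ^ 3 * x : GeneralLinearGroup (Fin 5) ℚ) : Matrix (Fin 5) (Fin 5) ℚ) =
      !![0, -1/2, -4, -1/2, -61/32;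
         2,   -8,  0,  3/8,    3/2;
         0,    0, -1, -1/4,     -1;
         0,    0,  0,    0,    1/2;
         0,    0,  0,   -2,     -8] := by
    rw [Units.val_mul, Units.val_mul, Units.val_pow_eq_pow_val, pow_succ, hy2, hx, hy]
    norm_num
  have hwG : x * y ^ 3 * x ∈ Subgroup.closure {x, y} :=
    mul_mem (mul_mem hxG (pow_mem hyG 3)) hxG
  generalize x * y ^ 3 * x = w at hw hwG
  have hz : ∃ z ∈ Subgroup.closure {x, y},
      (z : Matrix (Fin 5) (Fin 5) ℚ) = longHighestRoot 1 :=
    ⟨y ^ 16, pow_mem hyG 16, by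
      rw [Units.val_pow_eq_pow_val, show 16 = 4 * 4 from rfl, pow_mul, hy4, longHighestRoot_pow]
      norm_num⟩
  obtain ⟨z, hzG, hz⟩ := hz
  have hv : ∃ v ∈ Subgroup.closure {x, y},
      (v : Matrix (Fin 5) (Fin 5) ℚ) = longSimpleRoot 4 :=
    ⟨y⁻¹ * w, mul_mem (inv_mem hyG) hwG, by
      rw [Units.val_mul, Units.inv_mul_eq_iff_eq_mul, hw, hy, longSimpleRoot]
      norm_num⟩
  obtain ⟨v, hvG, hv⟩ := hv
  have hp : ∃ p ∈ Subgroup.closure {x, y},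
      (p : Matrix (Fin 5) (Fin 5) ℚ) = shortSimpleRoot 64 :=
    ⟨z ^ 4 * y ^ 2 * w * (w * y ^ 2)⁻¹,
      mul_mem (mul_mem (mul_mem (pow_mem hzG 4) (pow_mem hyG 2)) hwG)
        (inv_mem (mul_mem hwG (pow_mem hyG 2))), by
      apply val_mul_inv
      simp only [Units.val_mul, Units.val_pow_eq_pow_val, hz, longHighestRoot_pow, hy2, hw]
      norm_num [longHighestRoot, shortSimpleRoot]⟩
  obtain ⟨p, hpG, hp⟩ := hp
  have hq : ∃ q ∈ Subgroup.closure {x, y},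
      (q : Matrix (Fin 5) (Fin 5) ℚ) = shortHighestRoot (-32) :=
    ⟨z ^ 248 * p ^ 9 * (w * w * y ^ 2) * (y ^ 2 * (w * w))⁻¹,
      mul_mem (mul_mem (mul_mem (pow_mem hzG 248) (pow_mem hpG 9))
        (mul_mem (mul_mem hwG hwG) (pow_mem hyG 2)))
        (inv_mem (mul_mem (pow_mem hyG 2) (mul_mem hwG hwG))), by
      apply val_mul_inv
      simp only [Units.val_mul, Units.val_pow_eq_pow_val, hz, hp, longHighestRoot_pow,
        shortSimpleRoot_pow, hy2, hw]
      norm_num [longHighestRoot, shortSimpleRoot, shortHighestRoot]⟩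
  obtain ⟨q, hqG, hq⟩ := hq
  simp only [List.forall_mem_cons, List.not_mem_nil, false_imp_iff, implies_true, and_true]
  refine ⟨⟨z, hzG, hz⟩, ⟨q ^ 4, pow_mem hqG 4, ?_⟩, ⟨v ^ 4, pow_mem hvG 4, ?_⟩,
    ⟨p ^ 128, pow_mem hpG 128, ?_⟩⟩
  · rw [Units.val_pow_eq_pow_val, hq, shortHighestRoot_pow, shortHighestRoot]
    norm_num
  · rw [Units.val_pow_eq_pow_val, hv, longSimpleRoot_pow, longSimpleRoot]
    norm_num
  · rw [Units.val_pow_eq_pow_val, hp, shortSimpleRoot_pow, shortSimpleRoot]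
    norm_num
end
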